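/- Let P and π be probability measures on a measurable space Ω with π ≪ P and P ≪ π, and let R = dπ/dP. Define the escort measure q_τ by dq_τ/dP = R^τ / ∫ R^τ dP. Suppose that for every τ ∈ [0,1], ∫ R^τ |log R|² dP < ∞. Then the function τ ↦ D_KL(q_τ‖π) is differentiable on (0,1) with derivative −(1 − τ) · Var_{q_τ}(log R) ≤ 0, and hence τ ↦ D_KL(q_τ‖π) is nonincreasing on [0,1]. -/

import Mathlib

open MeasureTheory

/-- Kullback–Leibler divergence (real-valued): `D_KL(q‖p) = ∫ log (dq/dp) dq`. -/
noncomputable def klDiv {Ω : Type*} [MeasurableSpace Ω] (q p : Measure Ω) : ℝ :=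
  ∫ x, llr q p x ∂q

open ProbabilityTheory

section ExponentialFamily

variable {Ω : Type*} [MeasurableSpace Ω] {P : Measure Ω} [IsProbabilityMeasure P] {X : Ω → ℝ}

lemma exp_mul_le_one_add_exp {t : ℝ} (ht : t ∈ Set.Icc (0 : ℝ) 1) (x : ℝ) :
    Real.exp (t * x) ≤ 1 + Real.exp x := by
  rcases le_total 0 x with hx | hx
  · have : Real.exp (t * x) ≤ Real.exp x :=
      Real.exp_le_exp.2 (mul_le_of_le_one_left hx ht.2)
    linarith
  · have : Real.exp (t * x) ≤ 1 :=
      Real.exp_le_one_iff.2 (mul_nonpos_of_nonneg_of_nonpos ht.1 hx)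
    linarith [Real.exp_pos x]

lemma integrable_exp_mul_of_mem_Icc (hX : Measurable X)
    (hexp : Integrable (fun x => Real.exp (X x)) P) {t : ℝ} (ht : t ∈ Set.Icc (0 : ℝ) 1) :
    Integrable (fun x => Real.exp (t * X x)) P := by
  refine ((integrable_const (1 : ℝ)).add hexp).mono' (by fun_prop) (ae_of_all _ fun x => ?_)
  rw [Real.norm_eq_abs, Real.abs_exp]
  exact exp_mul_le_one_add_exp ht (X x)

lemma Ioo_subset_interior_integrableExpSet (hX : Measurable X)
    (hexp : Integrable (fun x => Real.exp (X x)) P) :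
    Set.Ioo (0 : ℝ) 1 ⊆ interior (integrableExpSet X P) :=
  interior_maximal
    (fun _ ht => integrable_exp_mul_of_mem_Icc hX hexp (Set.Ioo_subset_Icc_self ht)) isOpen_Ioo

/-- An integrable function dominating `x ↦ X x * exp (t * X x)` for all `t ∈ [0, 1]`. -/
lemma integrable_one_add_sq_mul_one_add_exp (hexp : Integrable (fun x => Real.exp (X x)) P)
    (hsq : Integrable (fun x => X x ^ 2) P)
    (hsqexp : Integrable (fun x => Real.exp (X x) * X x ^ 2) P) :
    Integrable (fun x => (1 + X x ^ 2) * (1 + Real.exp (X x))) P := by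
  refine ((((integrable_const (1 : ℝ)).add hexp).add hsq).add hsqexp).congr
    (ae_of_all _ fun x => ?_)
  simp only [Pi.add_apply]
  ring

lemma norm_mul_exp_mul_le {t : ℝ} (ht : t ∈ Set.Icc (0 : ℝ) 1) (x : ℝ) :
    ‖Real.exp (t * x) * x‖ ≤ (1 + x ^ 2) * (1 + Real.exp x) := by
  rw [norm_mul, Real.norm_eq_abs, Real.norm_eq_abs, Real.abs_exp, mul_comm]
  have hx : |x| ≤ 1 + x ^ 2 := by nlinarith [sq_nonneg (|x| - 1), sq_abs x]
  exact mul_le_mul hx (exp_mul_le_one_add_exp ht x) (Real.exp_pos _).le (by positivity)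

lemma integrable_tilted_mul_of_mem_Icc (hX : Measurable X)
    (hexp : Integrable (fun x => Real.exp (X x)) P)
    (hsq : Integrable (fun x => X x ^ 2) P)
    (hsqexp : Integrable (fun x => Real.exp (X x) * X x ^ 2) P)
    {t : ℝ} (ht : t ∈ Set.Icc (0 : ℝ) 1) :
    Integrable X (P.tilted (t * X ·)) := by
  rw [integrable_tilted_iff (integrable_exp_mul_of_mem_Icc hX hexp ht)]
  exact (integrable_one_add_sq_mul_one_add_exp hexp hsq hsqexp).mono' (by fun_prop)
    (ae_of_all _ fun x => norm_mul_exp_mul_le ht (X x))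

lemma continuousOn_mgf_Icc (hX : Measurable X) (hexp : Integrable (fun x => Real.exp (X x)) P) :
    ContinuousOn (mgf X P) (Set.Icc 0 1) := by
  refine continuousOn_of_dominated (bound := fun x => 1 + Real.exp (X x)) (fun t _ => by fun_prop)
    (fun t ht => ae_of_all _ fun x => ?_) ((integrable_const (1 : ℝ)).add hexp)
    (ae_of_all _ fun x => by fun_prop)
  rw [Real.norm_eq_abs, Real.abs_exp]
  exact exp_mul_le_one_add_exp ht (X x)

lemma continuousOn_cgf_Icc (hX : Measurable X) (hexp : Integrable (fun x => Real.exp (X x)) P) :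
    ContinuousOn (cgf X P) (Set.Icc 0 1) :=
  (continuousOn_mgf_Icc hX hexp).log
    fun _ ht => (mgf_pos (integrable_exp_mul_of_mem_Icc hX hexp ht)).ne'

lemma continuousOn_integral_tilted_mul_self_Icc (hX : Measurable X)
    (hexp : Integrable (fun x => Real.exp (X x)) P)
    (hsq : Integrable (fun x => X x ^ 2) P)
    (hsqexp : Integrable (fun x => Real.exp (X x) * X x ^ 2) P) :
    ContinuousOn (fun t => ∫ x, X x ∂(P.tilted (t * X ·))) (Set.Icc 0 1) := by
  have hnum : ContinuousOn (fun t => ∫ x, Real.exp (t * X x) * X x ∂P) (Set.Icc 0 1) :=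
    continuousOn_of_dominated (fun t _ => by fun_prop)
      (fun t ht => ae_of_all _ fun x => norm_mul_exp_mul_le ht (X x))
      (integrable_one_add_sq_mul_one_add_exp hexp hsq hsqexp)
      (ae_of_all _ fun x => by fun_prop)
  refine (hnum.div (continuousOn_mgf_Icc hX hexp)
    fun _ ht => (mgf_pos (integrable_exp_mul_of_mem_Icc hX hexp ht)).ne').congr fun t _ => ?_
  simp only [integral_tilted_mul_eq_mgf, Pi.div_apply, ← integral_div, smul_eq_mul]
  congr with x
  ring

lemma hasDerivAt_integral_tilted_mul_self {μ : Measure Ω} {t : ℝ}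
    (ht : t ∈ interior (integrableExpSet X μ)) :
    HasDerivAt (fun s => ∫ x, X x ∂(μ.tilted (s * X ·))) Var[X; μ.tilted (t * X ·)] t := by
  rw [variance_tilted_mul ht, iteratedDeriv_succ, iteratedDeriv_one]
  refine (analyticAt_cgf ht).deriv.differentiableAt.hasDerivAt.congr_of_eventuallyEq ?_
  filter_upwards [isOpen_interior.mem_nhds ht] with s hs using integral_tilted_mul_self hs

lemma variance_tilted_mul_eq_sub {t : ℝ} (ht : t ∈ interior (integrableExpSet X P)) :
    Var[X; P.tilted (t * X ·)] =
      ∫ x, X x ^ 2 ∂(P.tilted (t * X ·)) - (∫ x, X x ∂(P.tilted (t * X ·))) ^ 2 := by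
  have := isProbabilityMeasure_tilted (interior_subset (s := integrableExpSet X P) ht)
  exact variance_eq_sub (memLp_tilted_mul ht 2)

end ExponentialFamily

section EscortFamily

variable {Ω : Type*} [MeasurableSpace Ω] {P pi : Measure Ω}
  [IsProbabilityMeasure P] [IsProbabilityMeasure pi]

lemma withDensity_rnDeriv_rpow_eq_tilted (hPπ : P ≪ pi) (t : ℝ) :
    P.withDensity (fun x => ENNReal.ofReal
      ((pi.rnDeriv P x).toReal ^ t / ∫ y, (pi.rnDeriv P y).toReal ^ t ∂P)) =
      P.tilted (t * llr pi P ·) := by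
  have h : (fun x => (pi.rnDeriv P x).toReal ^ t) =ᵐ[P] fun x => Real.exp (t * llr pi P x) := by
    filter_upwards [exp_llr_of_ac' pi P hPπ] with x hx
    rw [← hx, ← Real.exp_mul, mul_comm]
  rw [Measure.tilted, integral_congr_ae h]
  refine withDensity_congr_ae ?_
  filter_upwards [h] with x hx
  rw [hx]

lemma klDiv_tilted_mul_llr (hPπ : P ≪ pi) {t : ℝ}
    (hexp : Integrable (fun x => Real.exp (t * llr pi P x)) P)
    (hint : Integrable (llr pi P) (P.tilted (t * llr pi P ·))) :
    klDiv (P.tilted (t * llr pi P ·)) pi =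
      (t - 1) * ∫ x, llr pi P x ∂(P.tilted (t * llr pi P ·)) - cgf (llr pi P) P t := by
  have := isProbabilityMeasure_tilted hexp
  have h : llr (P.tilted (t * llr pi P ·)) pi =ᵐ[P.tilted (t * llr pi P ·)]
      fun x => (t - 1) * llr pi P x - cgf (llr pi P) P t := by
    refine (tilted_absolutelyContinuous P _).ae_le ?_
    filter_upwards [llr_tilted_left hPπ hexp (by fun_prop), neg_llr hPπ] with x hx hneg
    rw [Pi.neg_apply] at hneg
    rw [hx, ← hneg, cgf, mgf]
    linarith
  rw [klDiv, integral_congr_ae h, integral_sub (hint.const_mul _) (integrable_const _),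
    integral_const_mul, integral_const]
  simp

end EscortFamily

/-- Along the escort path, `τ ↦ D_KL(q_τ‖π)` is differentiable on `(0,1)` with
derivative `−(1−τ) · Var_{q_τ}(log R) ≤ 0`, hence nonincreasing on `[0,1]`. -/
theorem escort_kl_to_target_antitone
    {Ω : Type*} [MeasurableSpace Ω] (P pi : Measure Ω)
    [IsProbabilityMeasure P] [IsProbabilityMeasure pi]
    (hπP : pi ≪ P) (hPπ : P ≪ pi)
    (R : Ω → ℝ) (hR : R = fun x => (pi.rnDeriv P x).toReal)
    (hmom : ∀ τ ∈ Set.Icc (0 : ℝ) 1,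
      Integrable (fun x => R x ^ τ * |Real.log (R x)| ^ 2) P)
    (q : ℝ → Measure Ω)
    (hq : ∀ τ, q τ = P.withDensity (fun x =>
      ENNReal.ofReal (R x ^ τ / ∫ y, R y ^ τ ∂P))) :
    (∀ τ ∈ Set.Ioo (0 : ℝ) 1,
      HasDerivAt (fun s => klDiv (q s) pi)
        (-(1 - τ) * ((∫ x, Real.log (R x) ^ 2 ∂(q τ)) - (∫ x, Real.log (R x) ∂(q τ)) ^ 2)) τ ∧
      -(1 - τ) * ((∫ x, Real.log (R x) ^ 2 ∂(q τ)) - (∫ x, Real.log (R x) ∂(q τ)) ^ 2) ≤ 0) ∧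
    AntitoneOn (fun s => klDiv (q s) pi) (Set.Icc (0 : ℝ) 1) := by
  subst hR
  set X := llr pi P with hX_def
  have hX : Measurable X := measurable_llr pi P
  have hexpX := exp_llr_of_ac' pi P hPπ
  have hexp : Integrable (fun x => Real.exp (X x)) P :=
    Measure.integrable_toReal_rnDeriv.congr hexpX.symm
  have hsq : Integrable (fun x => X x ^ 2) P := by
    simpa [sq_abs, X, llr] using hmom 0 (by simp)
  have hsqexp : Integrable (fun x => Real.exp (X x) * X x ^ 2) P := by
    refine (hmom 1 (by simp)).congr ?_
    filter_upwards [hexpX] with x hx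
    rw [hx, Real.rpow_one, sq_abs, hX_def, llr]
  have hq' : ∀ t, q t = P.tilted (t * X ·) := fun t =>
    (hq t).trans (withDensity_rnDeriv_rpow_eq_tilted hPπ t)
  have hlog : ∀ x, Real.log (pi.rnDeriv P x).toReal = X x := fun _ => rfl
  have hkl : Set.EqOn (fun s => klDiv (q s) pi)
      (fun s => (s - 1) * ∫ x, X x ∂(P.tilted (s * X ·)) - cgf X P s) (Set.Icc 0 1) := by
    intro s hs
    simp only [hq']
    exact klDiv_tilted_mul_llr hPπ (integrable_exp_mul_of_mem_Icc hX hexp hs)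
      (integrable_tilted_mul_of_mem_Icc hX hexp hsq hsqexp hs)
  have hderiv : ∀ t ∈ Set.Ioo (0 : ℝ) 1,
      HasDerivAt (fun s => klDiv (q s) pi) (-(1 - t) * Var[X; P.tilted (t * X ·)]) t := by
    intro t ht
    have hti := Ioo_subset_interior_integrableExpSet hX hexp ht
    have hcgf : HasDerivAt (cgf X P) (∫ x, X x ∂(P.tilted (t * X ·))) t := by
      rw [integral_tilted_mul_self hti]
      exact (analyticAt_cgf hti).differentiableAt.hasDerivAt
    refine ((((hasDerivAt_id t).sub_const 1).mul
      (hasDerivAt_integral_tilted_mul_self hti)).sub hcgf).congr_of_eventuallyEq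
        (hkl.eventuallyEq_of_mem (Icc_mem_nhds ht.1 ht.2)) |>.congr_deriv ?_
    simp only [id]
    ring
  have hnonpos : ∀ t ∈ Set.Ioo (0 : ℝ) 1, -(1 - t) * Var[X; P.tilted (t * X ·)] ≤ 0 :=
    fun t ht => mul_nonpos_of_nonpos_of_nonneg (by linarith [ht.2]) (variance_nonneg _ _)
  refine ⟨fun t ht => ?_, ?_⟩
  · simp only [hlog, hq' t,
      ← variance_tilted_mul_eq_sub (Ioo_subset_interior_integrableExpSet hX hexp ht)]
    exact ⟨hderiv t ht, hnonpos t ht⟩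
  · refine antitoneOn_of_deriv_nonpos (convex_Icc 0 1) ?_ ?_ ?_
    · exact (((continuousOn_id.sub continuousOn_const).mul
        (continuousOn_integral_tilted_mul_self_Icc hX hexp hsq hsqexp)).sub
          (continuousOn_cgf_Icc hX hexp)).congr hkl
    · rw [interior_Icc]
      exact fun t ht => (hderiv t ht).differentiableAt.differentiableWithinAt
    · rw [interior_Icc]
      exact fun t ht => (hderiv t ht).deriv ▸ hnonpos t ht
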